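/- (Exponential decay of the Lyapunov function.) Suppose additionally that μ(x) = γ m(x) for a constant γ > 0. Let β₀ = (ℓ²/2)√(m₁/r₀), β₁ = β₀ · (1 + (1/√(m₁ r₀)) · (ℓ² μ₁ + (2/ℓ)(k_a⁻ + k_a⁺))), let λ satisfy 0 < λ < min(1/β₀, γ m₀/(2 m₁)), set σ = 2λ/(1 + β₁ λ), and define L(t) = E(t) + λ J(t). Then for every t ∈ [0,T], L(t) ≤ e^{−σ t} L(0). -/

import Mathlib

open Set intervalIntegral

noncomputable def pdx (u : ℝ → ℝ → ℝ) (x t : ℝ) : ℝ := deriv (fun y => u y t) x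
noncomputable def pdt (u : ℝ → ℝ → ℝ) (x t : ℝ) : ℝ := deriv (fun s => u x s) t

noncomputable def beamEnergy (m r : ℝ → ℝ) (krm krp ℓ : ℝ) (u : ℝ → ℝ → ℝ) (t : ℝ) : ℝ :=
  (1/2) * (∫ x in (0:ℝ)..ℓ, (m x * (pdt u x t)^2 + r x * (pdx (pdx u) x t)^2))
    + (1/2) * krm * (pdx u 0 t)^2 + (1/2) * krp * (pdx u ℓ t)^2

noncomputable def beamJ (m μ : ℝ → ℝ) (kam kap ℓ : ℝ) (u : ℝ → ℝ → ℝ) (t : ℝ) : ℝ :=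
  (∫ x in (0:ℝ)..ℓ, m x * u x t * pdt u x t)
    + (1/2) * (∫ x in (0:ℝ)..ℓ, μ x * (u x t)^2)
    + (1/2) * kam * (pdx u 0 t)^2 + (1/2) * kap * (pdx u ℓ t)^2

section PartialDerivatives

variable {u v q : ℝ → ℝ → ℝ}

theorem hasDerivAt_uncurry_fst (hu : ContDiff ℝ (⊤ : ℕ∞) (Function.uncurry u)) (x t : ℝ) :
    HasDerivAt (fun y => u y t) (fderiv ℝ (Function.uncurry u) (x, t) (1, 0)) x :=
  ((hu.differentiable (by simp)) (x, t)).hasFDerivAt.comp_hasDerivAt x (f := fun y : ℝ => (y, t))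
    ((hasDerivAt_id x).prodMk (hasDerivAt_const x t))

theorem hasDerivAt_uncurry_snd (hu : ContDiff ℝ (⊤ : ℕ∞) (Function.uncurry u)) (x t : ℝ) :
    HasDerivAt (fun s => u x s) (fderiv ℝ (Function.uncurry u) (x, t) (0, 1)) t :=
  ((hu.differentiable (by simp)) (x, t)).hasFDerivAt.comp_hasDerivAt t (f := fun s : ℝ => (x, s))
    ((hasDerivAt_const t x).prodMk (hasDerivAt_id t))

theorem hasDerivAt_pdx (hu : ContDiff ℝ (⊤ : ℕ∞) (Function.uncurry u)) (x t : ℝ) :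
    HasDerivAt (fun y => u y t) (pdx u x t) x :=
  (hasDerivAt_uncurry_fst hu x t).differentiableAt.hasDerivAt

theorem hasDerivAt_pdt (hu : ContDiff ℝ (⊤ : ℕ∞) (Function.uncurry u)) (x t : ℝ) :
    HasDerivAt (fun s => u x s) (pdt u x t) t :=
  (hasDerivAt_uncurry_snd hu x t).differentiableAt.hasDerivAt

theorem pdx_eq_fderiv (hu : ContDiff ℝ (⊤ : ℕ∞) (Function.uncurry u)) (x t : ℝ) :
    pdx u x t = fderiv ℝ (Function.uncurry u) (x, t) (1, 0) :=
  (hasDerivAt_uncurry_fst hu x t).deriv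

theorem pdt_eq_fderiv (hu : ContDiff ℝ (⊤ : ℕ∞) (Function.uncurry u)) (x t : ℝ) :
    pdt u x t = fderiv ℝ (Function.uncurry u) (x, t) (0, 1) :=
  (hasDerivAt_uncurry_snd hu x t).deriv

theorem contDiff_pdx (hu : ContDiff ℝ (⊤ : ℕ∞) (Function.uncurry u)) :
    ContDiff ℝ (⊤ : ℕ∞) (Function.uncurry (pdx u)) := by
  have h : Function.uncurry (pdx u) = fun p => fderiv ℝ (Function.uncurry u) p (1, 0) :=
    funext fun p => pdx_eq_fderiv hu p.1 p.2
  rw [h]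
  exact (hu.fderiv_right (m := (⊤ : ℕ∞)) le_rfl).clm_apply contDiff_const

theorem contDiff_pdt (hu : ContDiff ℝ (⊤ : ℕ∞) (Function.uncurry u)) :
    ContDiff ℝ (⊤ : ℕ∞) (Function.uncurry (pdt u)) := by
  have h : Function.uncurry (pdt u) = fun p => fderiv ℝ (Function.uncurry u) p (0, 1) :=
    funext fun p => pdt_eq_fderiv hu p.1 p.2
  rw [h]
  exact (hu.fderiv_right (m := (⊤ : ℕ∞)) le_rfl).clm_apply contDiff_const

theorem pdt_pdx_comm (hu : ContDiff ℝ (⊤ : ℕ∞) (Function.uncurry u)) :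
    pdt (pdx u) = pdx (pdt u) := by
  have hd : Differentiable ℝ (fderiv ℝ (Function.uncurry u)) :=
    (hu.fderiv_right (m := (⊤ : ℕ∞)) le_rfl).differentiable (by simp)
  funext x t
  have hx : Function.uncurry (pdx u) = fun p => fderiv ℝ (Function.uncurry u) p (1, 0) :=
    funext fun p => pdx_eq_fderiv hu p.1 p.2
  have ht : Function.uncurry (pdt u) = fun p => fderiv ℝ (Function.uncurry u) p (0, 1) :=
    funext fun p => pdt_eq_fderiv hu p.1 p.2
  rw [pdt_eq_fderiv (contDiff_pdx hu), pdx_eq_fderiv (contDiff_pdt hu), hx, ht,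
    fderiv_clm_apply (hd _) (differentiableAt_const _),
    fderiv_clm_apply (hd _) (differentiableAt_const _)]
  have hs : IsSymmSndFDerivAt ℝ (Function.uncurry u) (x, t) :=
    hu.contDiffAt.isSymmSndFDerivAt (by
      rw [minSmoothness_of_isRCLikeNormedField]; exact WithTop.coe_le_coe.2 (le_top : (2 : ℕ∞) ≤ ⊤))
  simpa using hs (0, 1) (1, 0)

theorem continuous_slice_fst (hu : ContDiff ℝ (⊤ : ℕ∞) (Function.uncurry u)) (t : ℝ) :
    Continuous (fun x => u x t) :=
  hu.continuous.comp (Continuous.prodMk_left t)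

theorem integral_pdx_pdx_mul (hq : ContDiff ℝ (⊤ : ℕ∞) (Function.uncurry q))
    (hv : ContDiff ℝ (⊤ : ℕ∞) (Function.uncurry v)) {a b t : ℝ}
    (ha : v a t = 0) (hb : v b t = 0) :
    ∫ x in a..b, pdx (pdx q) x t * v x t =
      (∫ x in a..b, q x t * pdx (pdx v) x t) - (q b t * pdx v b t - q a t * pdx v a t) := by
  have hqx := contDiff_pdx hq
  have hvx := contDiff_pdx hv
  have h₁ := integral_mul_deriv_eq_deriv_mul (a := a) (b := b)
    (fun x _ => hasDerivAt_pdx hqx x t) (fun x _ => hasDerivAt_pdx hv x t)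
    ((continuous_slice_fst (contDiff_pdx hqx) t).intervalIntegrable _ _)
    ((continuous_slice_fst hvx t).intervalIntegrable _ _)
  have h₂ := integral_mul_deriv_eq_deriv_mul (a := a) (b := b)
    (fun x _ => hasDerivAt_pdx hq x t) (fun x _ => hasDerivAt_pdx hvx x t)
    ((continuous_slice_fst hqx t).intervalIntegrable _ _)
    ((continuous_slice_fst (contDiff_pdx hvx) t).intervalIntegrable _ _)
  rw [ha, hb] at h₁
  linarith

theorem intervalIntegrable_weight_mul {w f : ℝ → ℝ} {ℓ : ℝ} (hℓ : 0 ≤ ℓ)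
    (hw : ContinuousOn w (Icc 0 ℓ)) (hf : Continuous f) :
    IntervalIntegrable (fun x => w x * f x) MeasureTheory.volume 0 ℓ :=
  ContinuousOn.intervalIntegrable (by rw [uIcc_of_le hℓ]; exact hw.mul hf.continuousOn)

theorem hasDerivAt_integral_weight_mul {w : ℝ → ℝ} {ℓ : ℝ} (hℓ : 0 ≤ ℓ)
    (hw : ContinuousOn w (Icc 0 ℓ))
    (hu : ContDiff ℝ (⊤ : ℕ∞) (Function.uncurry u)) (t : ℝ) :
    HasDerivAt (fun s => ∫ x in (0:ℝ)..ℓ, w x * u x s) (∫ x in (0:ℝ)..ℓ, w x * pdt u x t) t := by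
  have hut := contDiff_pdt hu
  obtain ⟨C, hC⟩ := ((isCompact_Icc (a := (0:ℝ)) (b := ℓ)).prod
    (isCompact_Icc (a := t - 1) (b := t + 1))).exists_bound_of_continuousOn
    (f := fun p : ℝ × ℝ => w p.1 * pdt u p.1 p.2)
    ((hw.comp continuousOn_fst fun p hp => hp.1).mul hut.continuous.continuousOn)
  refine (intervalIntegral.hasDerivAt_integral_of_dominated_loc_of_deriv_le (bound := fun _ => C)
    (F' := fun s x => w x * pdt u x s)
    (Icc_mem_nhds (by linarith : t - 1 < t) (by linarith : t < t + 1)) ?_ ?_ ?_ ?_ ?_ ?_).2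
  · exact Filter.Eventually.of_forall fun s =>
      (intervalIntegrable_weight_mul hℓ hw (continuous_slice_fst hu s)).def'.aestronglyMeasurable
  · exact intervalIntegrable_weight_mul hℓ hw (continuous_slice_fst hu t)
  · exact (intervalIntegrable_weight_mul hℓ hw (continuous_slice_fst hut t)).def'.aestronglyMeasurable
  · refine Filter.Eventually.of_forall fun x hx s hs => hC (x, s) ⟨?_, hs⟩
    rw [uIoc_of_le hℓ] at hx
    exact Ioc_subset_Icc_self hx
  · exact intervalIntegrable_const
  · exact Filter.Eventually.of_forall fun x _ s _ => (hasDerivAt_pdt hu x s).const_mul _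

end PartialDerivatives

section Poincare

variable {f f' : ℝ → ℝ}

theorem sq_integral_le_mul_integral_sq {g : ℝ → ℝ} (hg : Continuous g) {a b : ℝ} (hab : a ≤ b) :
    (∫ x in a..b, g x) ^ 2 ≤ (b - a) * ∫ x in a..b, g x ^ 2 := by
  rcases hab.eq_or_lt with rfl | hlt
  · simp
  have hpos : 0 < b - a := sub_pos.2 hlt
  set c := (∫ x in a..b, g x) / (b - a) with hc
  have hcI : ∫ x in a..b, g x = c * (b - a) := by rw [hc]; field_simp
  have h0 : 0 ≤ ∫ x in a..b, (g x - c) ^ 2 :=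
    integral_nonneg hab fun x _ => sq_nonneg _
  have h1 : ∫ x in a..b, (g x - c) ^ 2 =
      (∫ x in a..b, g x ^ 2) - 2 * c * (∫ x in a..b, g x) + (b - a) * c ^ 2 := by
    have : (fun x => (g x - c) ^ 2) = fun x => (g x ^ 2 - 2 * c * g x) + c ^ 2 := by
      funext x; ring
    rw [this, integral_add, integral_sub, integral_const_mul, integral_const, smul_eq_mul]
    all_goals exact Continuous.intervalIntegrable (by fun_prop) _ _
  rw [h1, hcI] at h0
  rw [hcI]
  nlinarith

theorem sq_le_of_eq_zero (hf : ∀ x, HasDerivAt f (f' x) x) (hf' : Continuous f')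
    {a b ξ x : ℝ} (hξ : ξ ∈ Icc a b) (hx : x ∈ Icc a b) (h0 : f ξ = 0) :
    f x ^ 2 ≤ |x - ξ| * ∫ y in a..b, f' y ^ 2 := by
  have hint : ∀ c d : ℝ, ∫ y in c..d, f' y = f d - f c := fun c d =>
    integral_eq_sub_of_hasDerivAt (fun y _ => hf y) (hf'.intervalIntegrable _ _)
  have hmono : ∀ c d : ℝ, a ≤ c → c ≤ d → d ≤ b →
      ∫ y in c..d, f' y ^ 2 ≤ ∫ y in a..b, f' y ^ 2 := fun c d hc hcd hd =>
    integral_mono_interval hc hcd hd (Filter.Eventually.of_forall fun y => sq_nonneg _)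
      ((hf'.pow 2).intervalIntegrable _ _)
  rcases le_total ξ x with h | h
  · rw [abs_of_nonneg (sub_nonneg.2 h)]
    have := sq_integral_le_mul_integral_sq hf' h
    rw [hint, h0, sub_zero] at this
    exact this.trans (mul_le_mul_of_nonneg_left (hmono _ _ hξ.1 h hx.2) (sub_nonneg.2 h))
  · rw [abs_sub_comm, abs_of_nonneg (sub_nonneg.2 h)]
    have := sq_integral_le_mul_integral_sq hf' h
    rw [hint, h0, zero_sub, neg_sq] at this
    exact this.trans (mul_le_mul_of_nonneg_left (hmono _ _ hx.1 h hξ.2) (sub_nonneg.2 h))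

theorem integral_sq_le_of_eq_zero (hf : ∀ x, HasDerivAt f (f' x) x) (hf' : Continuous f')
    {a b ξ : ℝ} (hξ : ξ ∈ Icc a b) (h0 : f ξ = 0) :
    ∫ x in a..b, f x ^ 2 ≤ (b - a) ^ 2 / 2 * ∫ x in a..b, f' x ^ 2 := by
  have hfc : Continuous f := continuous_iff_continuousAt.2 fun x => (hf x).continuousAt
  have hab : a ≤ b := hξ.1.trans hξ.2
  set D := ∫ x in a..b, f' x ^ 2 with hD
  have hD0 : 0 ≤ D := integral_nonneg hab fun x _ => sq_nonneg _
  have hL : ∫ x in a..ξ, f x ^ 2 ≤ ∫ x in a..ξ, (ξ - x) * D := by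
    refine integral_mono_on hξ.1 ((hfc.pow 2).intervalIntegrable _ _)
      (Continuous.intervalIntegrable (by fun_prop) _ _) fun x hx => ?_
    have := sq_le_of_eq_zero hf hf' hξ ⟨hx.1, hx.2.trans hξ.2⟩ h0
    rwa [abs_sub_comm, abs_of_nonneg (sub_nonneg.2 hx.2)] at this
  have hR : ∫ x in ξ..b, f x ^ 2 ≤ ∫ x in ξ..b, (x - ξ) * D := by
    refine integral_mono_on hξ.2 ((hfc.pow 2).intervalIntegrable _ _)
      (Continuous.intervalIntegrable (by fun_prop) _ _) fun x hx => ?_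
    have := sq_le_of_eq_zero hf hf' hξ ⟨hξ.1.trans hx.1, hx.2⟩ h0
    rwa [abs_of_nonneg (sub_nonneg.2 hx.1)] at this
  have hL' : ∫ x in a..ξ, (ξ - x) * D = (ξ - a) ^ 2 / 2 * D := by
    rw [integral_mul_const, integral_sub intervalIntegrable_const
      (continuous_id'.intervalIntegrable _ _), integral_const, integral_id, smul_eq_mul]
    ring
  have hR' : ∫ x in ξ..b, (x - ξ) * D = (b - ξ) ^ 2 / 2 * D := by
    rw [integral_mul_const, integral_sub (continuous_id'.intervalIntegrable _ _)
      intervalIntegrable_const, integral_const, integral_id, smul_eq_mul]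
    ring
  have hadd : (∫ x in a..ξ, f x ^ 2) + ∫ x in ξ..b, f x ^ 2 = ∫ x in a..b, f x ^ 2 :=
    integral_add_adjacent_intervals ((hfc.pow 2).intervalIntegrable a ξ)
      ((hfc.pow 2).intervalIntegrable ξ b)
  have : 0 ≤ (ξ - a) * (b - ξ) * D :=
    mul_nonneg (mul_nonneg (sub_nonneg.2 hξ.1) (sub_nonneg.2 hξ.2)) hD0
  rw [hL'] at hL
  rw [hR'] at hR
  nlinarith

end Poincare

section Beam

variable {ℓ krm krp kam kap : ℝ} {m μ r : ℝ → ℝ} {u : ℝ → ℝ → ℝ}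

theorem beamEnergy_eq (hℓ : 0 ≤ ℓ) (hmc : ContinuousOn m (Icc 0 ℓ))
    (hrc : ContinuousOn r (Icc 0 ℓ)) (hu : ContDiff ℝ (⊤ : ℕ∞) (Function.uncurry u)) (t : ℝ) :
    beamEnergy m r krm krp ℓ u t =
      (1/2) * ((∫ x in (0:ℝ)..ℓ, m x * (pdt u x t)^2)
        + ∫ x in (0:ℝ)..ℓ, r x * (pdx (pdx u) x t)^2)
      + (1/2) * krm * (pdx u 0 t)^2 + (1/2) * krp * (pdx u ℓ t)^2 := by
  rw [beamEnergy, integral_add]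
  · exact intervalIntegrable_weight_mul hℓ hmc ((continuous_slice_fst (contDiff_pdt hu) t).pow 2)
  · exact intervalIntegrable_weight_mul hℓ hrc
      ((continuous_slice_fst (contDiff_pdx (contDiff_pdx hu)) t).pow 2)

theorem integral_pdx_pdx_mul_of_pde {q v : ℝ → ℝ → ℝ} {t : ℝ} (hℓ : 0 ≤ ℓ)
    (hmc : ContinuousOn m (Icc 0 ℓ)) (hμc : ContinuousOn μ (Icc 0 ℓ))
    (hu : ContDiff ℝ (⊤ : ℕ∞) (Function.uncurry u))
    (hv : ContDiff ℝ (⊤ : ℕ∞) (Function.uncurry v))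
    (hpde : ∀ x ∈ Ioo 0 ℓ,
      m x * pdt (pdt u) x t + μ x * pdt u x t + pdx (pdx q) x t = 0) :
    ∫ x in (0:ℝ)..ℓ, pdx (pdx q) x t * v x t =
      -(∫ x in (0:ℝ)..ℓ, m x * (pdt (pdt u) x t * v x t))
        - ∫ x in (0:ℝ)..ℓ, μ x * (pdt u x t * v x t) := by
  have hut := contDiff_pdt hu
  have hvc := continuous_slice_fst hv t
  have hm := intervalIntegrable_weight_mul hℓ hmc
    ((continuous_slice_fst (contDiff_pdt hut) t).mul hvc)
  have hμ := intervalIntegrable_weight_mul hℓ hμc ((continuous_slice_fst hut t).mul hvc)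
  rw [← intervalIntegral.integral_neg, ← integral_sub (by exact hm.neg) (by exact hμ)]
  refine integral_congr_Ioo_of_le hℓ fun x hx => ?_
  linear_combination (v x t) * hpde x hx

theorem hasDerivAt_beamEnergy {t : ℝ} (hℓ : 0 ≤ ℓ)
    (hmc : ContinuousOn m (Icc 0 ℓ)) (hμc : ContinuousOn μ (Icc 0 ℓ))
    (hrc : ContinuousOn r (Icc 0 ℓ))
    (hu : ContDiff ℝ (⊤ : ℕ∞) (Function.uncurry u))
    (hq : ContDiff ℝ (⊤ : ℕ∞) (Function.uncurry (fun x t => r x * pdx (pdx u) x t)))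
    (hpde : ∀ x ∈ Ioo 0 ℓ, m x * pdt (pdt u) x t + μ x * pdt u x t
        + pdx (pdx (fun y s => r y * pdx (pdx u) y s)) x t = 0)
    (h0 : pdt u 0 t = 0) (h1 : pdt u ℓ t = 0)
    (hb0 : -(r 0 * pdx (pdx u) 0 t) = -(krm * pdx u 0 t) - kam * pdt (pdx u) 0 t)
    (hb1 : -(r ℓ * pdx (pdx u) ℓ t) = krp * pdx u ℓ t + kap * pdt (pdx u) ℓ t) :
    HasDerivAt (beamEnergy m r krm krp ℓ u)
      (-(∫ x in (0:ℝ)..ℓ, μ x * (pdt u x t)^2)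
        - kam * (pdt (pdx u) 0 t)^2 - kap * (pdt (pdx u) ℓ t)^2) t := by
  have hut := contDiff_pdt hu
  have hux := contDiff_pdx hu
  have huxx := contDiff_pdx hux
  have d₁ := hasDerivAt_integral_weight_mul (u := fun x s => (pdt u x s)^2) hℓ hmc (hut.pow 2) t
  have d₂ := hasDerivAt_integral_weight_mul (u := fun x s => (pdx (pdx u) x s)^2) hℓ hrc
    (huxx.pow 2) t
  have d₃ := ((hasDerivAt_pdt hux 0 t).pow 2).const_mul ((1/2) * krm)
  have d₄ := ((hasDerivAt_pdt hux ℓ t).pow 2).const_mul ((1/2) * krp)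
  have d := (((d₁.add d₂).const_mul (1/2)).add d₃).add d₄
  rw [funext (beamEnergy_eq (krm := krm) (krp := krp) hℓ hmc hrc hu)]
  refine d.congr_deriv ?_
  have e₁ : ∫ x in (0:ℝ)..ℓ, m x * pdt (fun x s => (pdt u x s)^2) x t =
      2 * ∫ x in (0:ℝ)..ℓ, m x * (pdt (pdt u) x t * pdt u x t) := by
    rw [← integral_const_mul]
    refine integral_congr fun x _ => ?_
    have : pdt (fun x s => (pdt u x s)^2) x t = _ := ((hasDerivAt_pdt hut x t).pow 2).deriv
    simp only [this]
    push_cast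
    ring
  have e₂ : ∫ x in (0:ℝ)..ℓ, r x * pdt (fun x s => (pdx (pdx u) x s)^2) x t =
      2 * ∫ x in (0:ℝ)..ℓ, r x * pdx (pdx u) x t * pdx (pdx (pdt u)) x t := by
    rw [← integral_const_mul]
    refine integral_congr fun x _ => ?_
    have : pdt (fun x s => (pdx (pdx u) x s)^2) x t = _ :=
      ((hasDerivAt_pdt huxx x t).pow 2).deriv
    simp only [this, pdt_pdx_comm hux, pdt_pdx_comm hu]
    push_cast
    ring
  have hibp := integral_pdx_pdx_mul hq hut h0 h1
  rw [integral_pdx_pdx_mul_of_pde hℓ hmc hμc hu hut hpde] at hibp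
  have e₃ : ∫ x in (0:ℝ)..ℓ, μ x * (pdt u x t * pdt u x t) =
      ∫ x in (0:ℝ)..ℓ, μ x * (pdt u x t)^2 := by simp only [sq]
  rw [e₃] at hibp
  rw [e₁, e₂]
  rw [pdt_pdx_comm hu] at hb0 hb1 ⊢
  push_cast
  linear_combination -hibp - pdx (pdt u) ℓ t * hb1 + pdx (pdt u) 0 t * hb0

theorem hasDerivAt_beamJ {t : ℝ} (hℓ : 0 ≤ ℓ)
    (hmc : ContinuousOn m (Icc 0 ℓ)) (hμc : ContinuousOn μ (Icc 0 ℓ))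
    (hu : ContDiff ℝ (⊤ : ℕ∞) (Function.uncurry u))
    (hq : ContDiff ℝ (⊤ : ℕ∞) (Function.uncurry (fun x t => r x * pdx (pdx u) x t)))
    (hpde : ∀ x ∈ Ioo 0 ℓ, m x * pdt (pdt u) x t + μ x * pdt u x t
        + pdx (pdx (fun y s => r y * pdx (pdx u) y s)) x t = 0)
    (h0 : u 0 t = 0) (h1 : u ℓ t = 0)
    (hb0 : -(r 0 * pdx (pdx u) 0 t) = -(krm * pdx u 0 t) - kam * pdt (pdx u) 0 t)
    (hb1 : -(r ℓ * pdx (pdx u) ℓ t) = krp * pdx u ℓ t + kap * pdt (pdx u) ℓ t) :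
    HasDerivAt (beamJ m μ kam kap ℓ u)
      ((∫ x in (0:ℝ)..ℓ, m x * (pdt u x t)^2) - (∫ x in (0:ℝ)..ℓ, r x * (pdx (pdx u) x t)^2)
        - krm * (pdx u 0 t)^2 - krp * (pdx u ℓ t)^2) t := by
  have hut := contDiff_pdt hu
  have hux := contDiff_pdx hu
  have d₁ := hasDerivAt_integral_weight_mul (u := fun x s => u x s * pdt u x s) hℓ hmc
    (hu.mul hut) t
  have d₂ := hasDerivAt_integral_weight_mul (u := fun x s => (u x s)^2) hℓ hμc (hu.pow 2) t
  have d₃ := ((hasDerivAt_pdt hux 0 t).pow 2).const_mul ((1/2) * kam)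
  have d₄ := ((hasDerivAt_pdt hux ℓ t).pow 2).const_mul ((1/2) * kap)
  have d := ((d₁.add (d₂.const_mul (1/2))).add d₃).add d₄
  have hJ : beamJ m μ kam kap ℓ u = fun s => (∫ x in (0:ℝ)..ℓ, m x * (u x s * pdt u x s))
      + (1/2) * (∫ x in (0:ℝ)..ℓ, μ x * (u x s)^2)
      + (1/2) * kam * (pdx u 0 s)^2 + (1/2) * kap * (pdx u ℓ s)^2 := by
    funext s
    simp only [beamJ, mul_assoc]
  rw [hJ]
  refine d.congr_deriv ?_
  have e₁ : ∫ x in (0:ℝ)..ℓ, m x * pdt (fun x s => u x s * pdt u x s) x t =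
      (∫ x in (0:ℝ)..ℓ, m x * (pdt u x t)^2)
        + ∫ x in (0:ℝ)..ℓ, m x * (pdt (pdt u) x t * u x t) := by
    have i₁ := intervalIntegrable_weight_mul hℓ hmc ((continuous_slice_fst hut t).pow 2)
    have i₂ := intervalIntegrable_weight_mul hℓ hmc
      ((continuous_slice_fst (contDiff_pdt hut) t).mul (continuous_slice_fst hu t))
    rw [← integral_add (by exact i₁) (by exact i₂)]
    refine integral_congr fun x _ => ?_
    have : pdt (fun x s => u x s * pdt u x s) x t = _ :=
      ((hasDerivAt_pdt hu x t).mul (hasDerivAt_pdt hut x t)).deriv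
    simp only [this]
    ring
  have e₂ : ∫ x in (0:ℝ)..ℓ, μ x * pdt (fun x s => (u x s)^2) x t =
      2 * ∫ x in (0:ℝ)..ℓ, μ x * (pdt u x t * u x t) := by
    rw [← integral_const_mul]
    refine integral_congr fun x _ => ?_
    have : pdt (fun x s => (u x s)^2) x t = _ := ((hasDerivAt_pdt hu x t).pow 2).deriv
    simp only [this]
    push_cast
    ring
  have hibp := integral_pdx_pdx_mul hq hu h0 h1
  rw [integral_pdx_pdx_mul_of_pde hℓ hmc hμc hu hu hpde] at hibp
  have e₃ : ∫ x in (0:ℝ)..ℓ, r x * pdx (pdx u) x t * pdx (pdx u) x t =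
      ∫ x in (0:ℝ)..ℓ, r x * (pdx (pdx u) x t)^2 := by simp only [sq, mul_assoc]
  rw [e₃] at hibp
  rw [e₁, e₂]
  push_cast
  linear_combination -hibp - pdx u ℓ t * hb1 + pdx u 0 t * hb0

theorem beamJ_le_mul_beamEnergy {m₁ μ₁ r₀ β₀ β₁ t : ℝ} (hℓ : 0 < ℓ)
    (hm₁ : 0 < m₁) (hr₀ : 0 < r₀)
    (hkrm : 0 ≤ krm) (hkam : 0 ≤ kam) (hkrp : 0 ≤ krp) (hkap : 0 ≤ kap)
    (hmc : ContinuousOn m (Icc 0 ℓ)) (hμc : ContinuousOn μ (Icc 0 ℓ))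
    (hrc : ContinuousOn r (Icc 0 ℓ))
    (hmb : ∀ x ∈ Icc 0 ℓ, 0 ≤ m x ∧ m x ≤ m₁)
    (hμb : ∀ x ∈ Icc 0 ℓ, 0 ≤ μ x ∧ μ x ≤ μ₁)
    (hrb : ∀ x ∈ Icc 0 ℓ, r₀ ≤ r x)
    (hu : ContDiff ℝ (⊤ : ℕ∞) (Function.uncurry u))
    (h0 : u 0 t = 0) (h1 : u ℓ t = 0)
    (hβ₀ : β₀ = ℓ^2/2 * Real.sqrt (m₁/r₀))
    (hβ₁ : β₁ = β₀ * (1 + 1/Real.sqrt (m₁*r₀) * (ℓ^2*μ₁ + 2/ℓ * (kam + kap)))) :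
    beamJ m μ kam kap ℓ u t ≤ β₁ * beamEnergy m r krm krp ℓ u t := by
  have hut := contDiff_pdt hu
  have hux := contDiff_pdx hu
  have huxx := contDiff_pdx hux
  have cu := continuous_slice_fst hu t
  have cut := continuous_slice_fst hut t
  have cux := continuous_slice_fst hux t
  have cuxx := continuous_slice_fst huxx t
  have hs₁ : 0 < Real.sqrt (m₁/r₀) := Real.sqrt_pos.2 (div_pos hm₁ hr₀)
  have hβ₀pos : 0 < β₀ := by rw [hβ₀]; positivity
  have hβ₀sq : β₀^2 * r₀ = ℓ^4/4 * m₁ := by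
    rw [hβ₀, mul_pow, Real.sq_sqrt (div_pos hm₁ hr₀).le]
    field_simp
    ring
  have hμ₁ : 0 ≤ μ₁ := (hμb 0 ⟨le_rfl, hℓ.le⟩).1.trans (hμb 0 ⟨le_rfl, hℓ.le⟩).2
  have hβ₁' : β₁ = β₀ + (ℓ^4*μ₁/2 + ℓ * (kam + kap)) / r₀ := by
    have hs : Real.sqrt (m₁/r₀) = Real.sqrt (m₁*r₀) / r₀ := by
      rw [eq_div_iff hr₀.ne']
      nth_rewrite 2 [← Real.sqrt_sq hr₀.le]
      rw [← Real.sqrt_mul (div_pos hm₁ hr₀).le]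
      congr 1
      field_simp
    have hs₂ : 0 < Real.sqrt (m₁*r₀) := Real.sqrt_pos.2 (mul_pos hm₁ hr₀)
    rw [hβ₁, hβ₀, hs]
    field_simp
  obtain ⟨ξ, hξ, hξ0⟩ := exists_hasDerivAt_eq_zero hℓ cu.continuousOn (h0.trans h1.symm)
    fun x _ => hasDerivAt_pdx hu x t
  have hξ' := Ioo_subset_Icc_self hξ
  have hmem0 : (0:ℝ) ∈ Icc 0 ℓ := ⟨le_rfl, hℓ.le⟩
  have hmem1 : ℓ ∈ Icc 0 ℓ := ⟨hℓ.le, le_rfl⟩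
  set A := ∫ x in (0:ℝ)..ℓ, m x * (pdt u x t)^2 with hA
  set B := ∫ x in (0:ℝ)..ℓ, r x * (pdx (pdx u) x t)^2 with hB
  set D := ∫ x in (0:ℝ)..ℓ, (pdx (pdx u) x t)^2 with hD
  set U := ∫ x in (0:ℝ)..ℓ, (u x t)^2 with hU
  have hD0 : 0 ≤ D := integral_nonneg hℓ.le fun x _ => sq_nonneg _
  have hA0 : 0 ≤ A := integral_nonneg hℓ.le fun x hx => mul_nonneg (hmb x hx).1 (sq_nonneg _)
  have hDB : r₀ * D ≤ B := by
    rw [hD, ← integral_const_mul]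
    exact integral_mono_on hℓ.le ((continuous_const.mul (cuxx.pow 2)).intervalIntegrable _ _)
      (intervalIntegrable_weight_mul hℓ.le hrc (cuxx.pow 2))
      fun x hx => mul_le_mul_of_nonneg_right (hrb x hx) (sq_nonneg _)
  have hUD : U ≤ ℓ^4/4 * D := by
    have i₁ := integral_sq_le_of_eq_zero (fun x => hasDerivAt_pdx hu x t) cux hmem0 h0
    have i₂ := integral_sq_le_of_eq_zero (fun x => hasDerivAt_pdx hux x t) cuxx hξ' hξ0
    have i₃ := mul_le_mul_of_nonneg_left i₂ (by positivity : 0 ≤ (ℓ - 0)^2/2)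
    calc U ≤ _ := i₁
      _ ≤ _ := i₃
      _ = ℓ^4/4 * D := by ring
  have hslope : ∀ x ∈ Icc 0 ℓ, (pdx u x t)^2 ≤ ℓ * D := fun x hx =>
    (sq_le_of_eq_zero (fun x => hasDerivAt_pdx hux x t) cuxx hξ' hx hξ0).trans
      (mul_le_mul_of_nonneg_right
        (abs_sub_le_iff.2 ⟨by linarith [hx.2, hξ'.1], by linarith [hx.1, hξ'.2]⟩) hD0)
  have hcross : ∫ x in (0:ℝ)..ℓ, m x * u x t * pdt u x t ≤ β₀/2 * A + β₀/2 * B := by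
    have i₁ : ∫ x in (0:ℝ)..ℓ, m x * u x t * pdt u x t ≤
        ∫ x in (0:ℝ)..ℓ, (β₀/2 * (m x * (pdt u x t)^2) + m₁/(2*β₀) * (u x t)^2) := by
      refine integral_mono_on hℓ.le ?_ ?_ fun x hx => ?_
      · simp only [mul_assoc]
        exact intervalIntegrable_weight_mul hℓ.le hmc (cu.mul cut)
      · exact ((intervalIntegrable_weight_mul hℓ.le hmc (cut.pow 2)).const_mul _).add
          ((continuous_const.mul (cu.pow 2)).intervalIntegrable _ _)
      · have h₁ : m x * u x t * pdt u x t ≤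
            β₀/2 * (m x * (pdt u x t)^2) + m x/(2*β₀) * (u x t)^2 := by
          have : β₀/2 * (m x * (pdt u x t)^2) + m x/(2*β₀) * (u x t)^2
              - m x * u x t * pdt u x t = m x/(2*β₀) * (β₀ * pdt u x t - u x t)^2 := by
            field_simp
            ring
          have h₂ : 0 ≤ m x/(2*β₀) * (β₀ * pdt u x t - u x t)^2 :=
            mul_nonneg (div_nonneg (hmb x hx).1 (by positivity)) (sq_nonneg _)
          linarith
        have h₃ : m x/(2*β₀) * (u x t)^2 ≤ m₁/(2*β₀) * (u x t)^2 := by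
          have := (hmb x hx).2
          gcongr
        linarith
    rw [integral_add
      (by exact (intervalIntegrable_weight_mul hℓ.le hmc (cut.pow 2)).const_mul _)
      (by exact (continuous_const.mul (cu.pow 2)).intervalIntegrable _ _), integral_const_mul,
      integral_const_mul] at i₁
    have i₂ : m₁/(2*β₀) * U ≤ β₀/2 * B := calc
      m₁/(2*β₀) * U ≤ m₁/(2*β₀) * (ℓ^4/4 * D) := by gcongr
      _ = (ℓ^4/4 * m₁)/(2*β₀) * D := by ring
      _ = β₀/2 * (r₀ * D) := by rw [← hβ₀sq]; field_simp
      _ ≤ β₀/2 * B := by gcongr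
    linarith
  have hdamp : ∫ x in (0:ℝ)..ℓ, μ x * (u x t)^2 ≤ μ₁ * U := by
    rw [hU, ← integral_const_mul]
    exact integral_mono_on hℓ.le (intervalIntegrable_weight_mul hℓ.le hμc (cu.pow 2))
      ((continuous_const.mul (cu.pow 2)).intervalIntegrable _ _)
      fun x hx => mul_le_mul_of_nonneg_right (hμb x hx).2 (sq_nonneg _)
  set κ := (ℓ^4*μ₁/2 + ℓ * (kam + kap)) / r₀ with hκ
  have hκ0 : 0 ≤ κ := by positivity
  have hκD : (ℓ^4*μ₁/2 + ℓ * (kam + kap)) * D ≤ κ * B := by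
    have : (ℓ^4*μ₁/2 + ℓ * (kam + kap)) * D = κ * (r₀ * D) := by
      rw [hκ]; field_simp
    rw [this]
    gcongr
  have hE : (1/2) * (A + B) ≤ beamEnergy m r krm krp ℓ u t := by
    rw [beamEnergy_eq hℓ.le hmc hrc hu]
    have := mul_nonneg hkrm (sq_nonneg (pdx u 0 t))
    have := mul_nonneg hkrp (sq_nonneg (pdx u ℓ t))
    linarith
  have hμU := mul_le_mul_of_nonneg_left hUD hμ₁
  have hμD : 0 ≤ ℓ^4 * μ₁ * D := by positivity
  have hk0 := mul_le_mul_of_nonneg_left (hslope 0 hmem0) hkam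
  have hk1 := mul_le_mul_of_nonneg_left (hslope ℓ hmem1) hkap
  have hJ : beamJ m μ kam kap ℓ u t ≤ (β₀ + κ) * ((1/2) * (A + B)) := by
    rw [beamJ]
    have := mul_nonneg hκ0 hA0
    linarith
  rw [hβ₁']
  exact hJ.trans (mul_le_mul_of_nonneg_left hE (by positivity))

end Beam

theorem lyapunov_exponential_decay
    (ℓ T m₀ m₁ μ₀ μ₁ r₀ r₁ krm kam krp kap : ℝ)
    (m μ r : ℝ → ℝ) (u : ℝ → ℝ → ℝ)
    (hℓ : 0 < ℓ) (hT : 0 < T)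
    (hm₀ : 0 < m₀) (hμ₀ : 0 ≤ μ₀) (hr₀ : 0 < r₀)
    (hmc : ContinuousOn m (Icc 0 ℓ)) (hμc : ContinuousOn μ (Icc 0 ℓ))
    (hrc : ContinuousOn r (Icc 0 ℓ))
    (hmb : ∀ x ∈ Icc 0 ℓ, m₀ ≤ m x ∧ m x ≤ m₁)
    (hμb : ∀ x ∈ Icc 0 ℓ, μ₀ ≤ μ x ∧ μ x ≤ μ₁)
    (hrb : ∀ x ∈ Icc 0 ℓ, r₀ ≤ r x ∧ r x ≤ r₁)
    (hkrm : 0 ≤ krm) (hkam : 0 ≤ kam) (hkrp : 0 ≤ krp) (hkap : 0 ≤ kap)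
    (hu : ContDiff ℝ (⊤ : ℕ∞) (Function.uncurry u))
    (hq : ContDiff ℝ (⊤ : ℕ∞) (Function.uncurry (fun x t => r x * pdx (pdx u) x t)))
    (hpde : ∀ x ∈ Ioo 0 ℓ, ∀ t ∈ Ioo 0 T,
      m x * pdt (pdt u) x t + μ x * pdt u x t
        + pdx (pdx (fun y s => r y * pdx (pdx u) y s)) x t = 0)
    (hbu0 : ∀ t ∈ Icc 0 T, u 0 t = 0)
    (hbuℓ : ∀ t ∈ Icc 0 T, u ℓ t = 0)
    (hbm0 : ∀ t ∈ Icc 0 T,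
      -(r 0 * pdx (pdx u) 0 t) = -(krm * pdx u 0 t) - kam * pdt (pdx u) 0 t)
    (hbmℓ : ∀ t ∈ Icc 0 T,
      -(r ℓ * pdx (pdx u) ℓ t) = krp * pdx u ℓ t + kap * pdt (pdx u) ℓ t)
    (γ : ℝ) (hγ : 0 < γ) (hμm : ∀ x ∈ Icc 0 ℓ, μ x = γ * m x)
    (β₀ β₁ : ℝ)
    (hβ₀ : β₀ = ℓ^2/2 * Real.sqrt (m₁/r₀))
    (hβ₁ : β₁ = β₀ * (1 + 1/Real.sqrt (m₁*r₀) * (ℓ^2*μ₁ + 2/ℓ * (kam + kap))))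
    (lam σ : ℝ)
    (hlam₁ : 0 < lam) (hlam₂ : lam < min (1/β₀) (γ * m₀ / (2 * m₁)))
    (hσ : σ = 2 * lam / (1 + β₁ * lam)) :
    ∀ t ∈ Icc 0 T,
      beamEnergy m r krm krp ℓ u t + lam * beamJ m μ kam kap ℓ u t
        ≤ Real.exp (-σ * t) * (beamEnergy m r krm krp ℓ u 0 + lam * beamJ m μ kam kap ℓ u 0) := by
  have hm₁ : 0 < m₁ := by
    have h := hmb 0 ⟨le_rfl, hℓ.le⟩
    linarith
  have hμ₁ : 0 ≤ μ₁ := by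
    have h := hμb 0 ⟨le_rfl, hℓ.le⟩
    linarith
  have hm : ∀ x ∈ Icc 0 ℓ, 0 ≤ m x ∧ m x ≤ m₁ := fun x hx =>
    ⟨hm₀.le.trans (hmb x hx).1, (hmb x hx).2⟩
  have hlamγ : 2 * lam ≤ γ := by
    have h₁ : m₀ ≤ m₁ := (hmb 0 ⟨le_rfl, hℓ.le⟩).1.trans (hmb 0 ⟨le_rfl, hℓ.le⟩).2
    have h₂ : lam < γ * m₀ / (2 * m₁) := hlam₂.trans_le (min_le_right _ _)
    rw [lt_div_iff₀ (by positivity)] at h₂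
    have h₃ := mul_le_mul_of_nonneg_left h₁ hγ.le
    exact le_of_mul_le_mul_right (by linarith) hm₁
  have hβ₁0 : 0 ≤ β₁ := by
    have : 0 ≤ β₀ := by rw [hβ₀]; positivity
    rw [hβ₁]
    positivity
  have hden : 0 < 1 + β₁ * lam := by positivity
  have hσ0 : 0 ≤ σ := by rw [hσ]; positivity
  set L : ℝ → ℝ := fun t => beamEnergy m r krm krp ℓ u t + lam * beamJ m μ kam kap ℓ u t with hL
  have hLcont : Continuous L := by
    have hut := contDiff_pdt hu
    have hux := contDiff_pdx hu
    have huxx := contDiff_pdx hux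
    have c : ∀ {w : ℝ → ℝ} {v : ℝ → ℝ → ℝ}, ContinuousOn w (Icc 0 ℓ) →
        ContDiff ℝ (⊤ : ℕ∞) (Function.uncurry v) →
        Continuous fun t => ∫ x in (0:ℝ)..ℓ, w x * v x t := fun hw hv =>
      continuous_iff_continuousAt.2 fun t =>
        (hasDerivAt_integral_weight_mul hℓ.le hw hv t).continuousAt
    have c₁ := c (v := fun x s => (pdt u x s)^2) hmc (hut.pow 2)
    have c₂ := c (v := fun x s => (pdx (pdx u) x s)^2) hrc (huxx.pow 2)
    have c₃ := c (v := fun x s => u x s * pdt u x s) hmc (hu.mul hut)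
    have c₄ := c (v := fun x s => (u x s)^2) hμc (hu.pow 2)
    have cx : ∀ x, Continuous fun t => pdx u x t := fun x =>
      hux.continuous.comp (Continuous.prodMk_right x)
    have cx0 := cx 0
    have cxℓ := cx ℓ
    simp only [hL, beamEnergy_eq hℓ.le hmc hrc hu, beamJ, mul_assoc (m _)]
    fun_prop
  have hpos : ∀ t, L t = beamEnergy m r krm krp ℓ u t + lam * beamJ m μ kam kap ℓ u t :=
    fun _ => rfl
  have hLderiv : ∀ t ∈ Ioo 0 T, ∃ L' ≤ -σ * L t, HasDerivAt L L' t := by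
    intro t ht
    have htc := Ioo_subset_Icc_self ht
    have hvel : ∀ x, (∀ s ∈ Icc 0 T, u x s = 0) → pdt u x t = 0 := fun x hx => by
      have : (fun s => u x s) =ᶠ[nhds t] fun _ => 0 :=
        Filter.eventually_of_mem (Icc_mem_nhds ht.1 ht.2) hx
      rw [pdt, this.deriv_eq, deriv_const]
    have dE := hasDerivAt_beamEnergy hℓ.le hmc hμc hrc hu hq (fun x hx => hpde x hx t ht)
      (hvel 0 hbu0) (hvel ℓ hbuℓ) (hbm0 t htc) (hbmℓ t htc)
    have dJ := hasDerivAt_beamJ hℓ.le hmc hμc hu hq (fun x hx => hpde x hx t ht)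
      (hbu0 t htc) (hbuℓ t htc) (hbm0 t htc) (hbmℓ t htc)
    refine ⟨_, ?_, dE.add (dJ.const_mul lam)⟩
    have hJE := beamJ_le_mul_beamEnergy (krm := krm) (krp := krp) hℓ hm₁ hr₀ hkrm hkam hkrp hkap
      hmc hμc hrc hm (fun x hx => ⟨hμ₀.trans (hμb x hx).1, (hμb x hx).2⟩)
      (fun x hx => (hrb x hx).1) hu (hbu0 t htc) (hbuℓ t htc) hβ₀ hβ₁
    have hσL : σ * L t ≤ 2 * lam * beamEnergy m r krm krp ℓ u t := calc
      σ * L t ≤ σ * ((1 + β₁ * lam) * beamEnergy m r krm krp ℓ u t) := by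
        refine mul_le_mul_of_nonneg_left ?_ hσ0
        have := mul_le_mul_of_nonneg_left hJE hlam₁.le
        rw [hpos]
        linarith
      _ = 2 * lam * beamEnergy m r krm krp ℓ u t := by
        rw [hσ]
        field_simp
    have hμA : ∫ x in (0:ℝ)..ℓ, μ x * (pdt u x t)^2 =
        γ * ∫ x in (0:ℝ)..ℓ, m x * (pdt u x t)^2 := by
      rw [← integral_const_mul]
      refine integral_congr fun x hx => ?_
      rw [uIcc_of_le hℓ.le] at hx
      simp only [hμm x hx, mul_assoc]
    have hA0 : 0 ≤ ∫ x in (0:ℝ)..ℓ, m x * (pdt u x t)^2 :=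
      integral_nonneg hℓ.le fun x hx => mul_nonneg (hm x hx).1 (sq_nonneg _)
    have hγA := mul_le_mul_of_nonneg_right hlamγ hA0
    have hd0 := mul_nonneg hkam (sq_nonneg (pdt (pdx u) 0 t))
    have hdℓ := mul_nonneg hkap (sq_nonneg (pdt (pdx u) ℓ t))
    rw [beamEnergy_eq hℓ.le hmc hrc hu] at hσL
    rw [hμA]
    linarith
  have hanti : AntitoneOn (fun t => Real.exp (σ * t) * L t) (Icc 0 T) := by
    have hd : ∀ t ∈ Ioo 0 T, ∃ D ≤ 0, HasDerivAt (fun t => Real.exp (σ * t) * L t) D t := by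
      intro t ht
      obtain ⟨L', hL'le, hL'⟩ := hLderiv t ht
      refine ⟨_, ?_, (((hasDerivAt_id' t).const_mul σ).exp).mul hL'⟩
      have := mul_le_mul_of_nonneg_left hL'le (Real.exp_pos (σ * t)).le
      linarith
    refine antitoneOn_of_deriv_nonpos (convex_Icc 0 T) (by fun_prop) ?_ ?_
    · rw [interior_Icc]
      intro t ht
      obtain ⟨D, _, hD⟩ := hd t ht
      exact hD.differentiableAt.differentiableWithinAt
    · rw [interior_Icc]
      intro t ht
      obtain ⟨D, hD0, hD⟩ := hd t ht
      rwa [hD.deriv]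
  intro t ht
  have h := hanti ⟨le_rfl, hT.le⟩ ht ht.1
  simp only [mul_zero, Real.exp_zero, one_mul] at h
  calc L t = Real.exp (-σ * t) * (Real.exp (σ * t) * L t) := by
        rw [← mul_assoc, ← Real.exp_add]
        simp
    _ ≤ Real.exp (-σ * t) * L 0 := mul_le_mul_of_nonneg_left h (Real.exp_pos _).le
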